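/- Let k be a field, S = k[x₀,…,x_n] the polynomial ring in n+1 variables, q ≥ 1 an integer, and f ∈ S a homogeneous polynomial of degree d > 0. Set I = (x₀^q,…,x_n^q), let c_i = dim_k of the degree-i component of S/I (with c_i = 0 for i < 0), and let L(q) = Σ_i max{c_i − c_{i−d}, 0}. Then L(q) ≤ dim_k S/(I + (f)) ≤ q^{n+1}, and the upper bound is an equality if and only if f ∈ I. -/

import Mathlib

open MvPolynomial

/-- The dimension of the degree-`j` homogeneous component of `S/J`, where
`S = k[x₀,…,x_{N−1}]`: the `k`-dimension of the image in `S/J` of the space of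
homogeneous polynomials of degree `j` (zero for negative `j`). -/
noncomputable def quotComponentDim (k : Type*) [Field k] (N : ℕ)
    (J : Ideal (MvPolynomial (Fin N) k)) (j : ℤ) : ℕ :=
  if 0 ≤ j then
    Module.finrank k ((homogeneousSubmodule (Fin N) k j.toNat).map
      (Ideal.Quotient.mkₐ k J).toLinearMap)
  else 0

section HomogeneousQuotient

variable {σ k : Type*} [Field k]

/-- The degree-`i` component of `S/J`, as a subspace of `S/J`. -/
noncomputable abbrev quotComponent (J : Ideal (MvPolynomial σ k)) (i : ℕ) :
    Submodule k (MvPolynomial σ k ⧸ J) :=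
  (homogeneousSubmodule σ k i).map (Ideal.Quotient.mkₐ k J).toLinearMap

theorem quotComponentDim_natCast {N : ℕ} (J : Ideal (MvPolynomial (Fin N) k)) (i : ℕ) :
    quotComponentDim k N J i = Module.finrank k (quotComponent J i) := by
  simp [quotComponentDim]

theorem quotComponentDim_of_neg {N : ℕ} (J : Ideal (MvPolynomial (Fin N) k)) {j : ℤ}
    (hj : j < 0) : quotComponentDim k N J j = 0 := by
  exact if_neg hj.not_ge

attribute [local instance] MvPolynomial.gradedAlgebra

theorem homogeneousComponent_mul_of_le {f : MvPolynomial σ k} {d i : ℕ}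
    (hf : f.IsHomogeneous d) (h : d ≤ i) (g : MvPolynomial σ k) :
    homogeneousComponent i (g * f) = homogeneousComponent (i - d) g * f := by
  have := DirectSum.coe_decompose_mul_of_right_mem_of_le (homogeneousSubmodule σ k)
    (a := g) (b := f) (i := d) (n := i) hf h
  rw [← decomposition.decompose'_apply, ← decomposition.decompose'_apply]
  exact this

theorem homogeneousComponent_mul_of_lt {f : MvPolynomial σ k} {d i : ℕ}
    (hf : f.IsHomogeneous d) (h : i < d) (g : MvPolynomial σ k) :
    homogeneousComponent i (g * f) = 0 := by
  have := DirectSum.coe_decompose_mul_of_right_mem_of_not_le (homogeneousSubmodule σ k)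
    (a := g) (b := f) (i := d) (n := i) hf h.not_ge
  rw [← decomposition.decompose'_apply]
  exact this

/-- The dimensions of finitely many graded components of the quotient by a homogeneous ideal
add up to at most the dimension of the quotient. -/
theorem sum_finrank_quotComponent_le {J : Ideal (MvPolynomial σ k)}
    (hJ : J.IsHomogeneous (homogeneousSubmodule σ k))
    [FiniteDimensional k (MvPolynomial σ k ⧸ J)] (s : Finset ℕ) :
    ∑ i ∈ s, Module.finrank k (quotComponent J i) ≤
      Module.finrank k (MvPolynomial σ k ⧸ J) := by
  let proj (i : ℕ) : MvPolynomial σ k →ₗ[k] quotComponent J i :=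
    ((Ideal.Quotient.mkₐ k J).toLinearMap.comp (homogeneousComponent i)).codRestrict _
      fun p => Submodule.mem_map_of_mem (homogeneousComponent_mem i p)
  let Φ : (MvPolynomial σ k ⧸ J) →ₗ[k] (i : s) → quotComponent J i :=
    (J.restrictScalars k).liftQ (LinearMap.pi fun i : s => proj i) fun p hp => by
      ext i
      exact Ideal.Quotient.eq_zero_iff_mem.mpr (homogeneousComponent_mem_of_mem hJ hp i)
  have hΦ : Function.Surjective Φ := by
    intro w
    have hw (i : s) : ∃ p ∈ homogeneousSubmodule σ k (i : ℕ),
        (Ideal.Quotient.mkₐ k J).toLinearMap p = w i := (w i).2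
    choose p hp hpw using hw
    refine ⟨Ideal.Quotient.mk J (∑ j : s, p j), funext fun i => Subtype.ext ?_⟩
    change Ideal.Quotient.mk J (homogeneousComponent (i : ℕ) (∑ j : s, p j)) = _
    rw [← hpw i, map_sum, Finset.sum_eq_single i]
    · rw [homogeneousComponent_of_mem (hp i), if_pos rfl]; rfl
    · intro j _ hj
      rw [homogeneousComponent_of_mem (hp j), if_neg fun h => hj (Subtype.ext h.symm)]
    · simp
  have := LinearMap.finrank_le_finrank_of_surjective hΦ
  rwa [Module.finrank_pi_fintype, Finset.sum_coe_sort s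
    fun i => Module.finrank k (quotComponent J i)] at this

/-- A class of degree `i` in `S/I` killed in `S/(I + (f))` is a multiple of `f`. -/
theorem exists_isHomogeneous_sub_mul_mem {I : Ideal (MvPolynomial σ k)}
    (hI : I.IsHomogeneous (homogeneousSubmodule σ k)) {f p : MvPolynomial σ k} {d i : ℕ}
    (hf : f.IsHomogeneous d) (hp : p.IsHomogeneous i) (hpJ : p ∈ I + Ideal.span {f}) :
    (i < d ∧ p ∈ I) ∨ (d ≤ i ∧ ∃ g : MvPolynomial σ k, g.IsHomogeneous (i - d) ∧
      p - g * f ∈ I) := by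
  obtain ⟨a, ha, b, hb, rfl⟩ := Submodule.mem_sup.mp hpJ
  obtain ⟨g, rfl⟩ := Ideal.mem_span_singleton'.mp hb
  have hcomp := homogeneousComponent_eq_self hp
  rw [map_add] at hcomp
  have haI := homogeneousComponent_mem_of_mem hI ha i
  rcases lt_or_ge i d with h | h
  · rw [homogeneousComponent_mul_of_lt hf h, add_zero] at hcomp
    exact Or.inl ⟨h, hcomp ▸ haI⟩
  · rw [homogeneousComponent_mul_of_le hf h] at hcomp
    refine Or.inr ⟨h, homogeneousComponent (i - d) g, homogeneousComponent_isHomogeneous _ _, ?_⟩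
    rwa [← hcomp, add_sub_cancel_right]

theorem finrank_quotComponent_le {N : ℕ} {I : Ideal (MvPolynomial (Fin N) k)}
    (hI : I.IsHomogeneous (homogeneousSubmodule (Fin N) k))
    [FiniteDimensional k (MvPolynomial (Fin N) k ⧸ I)]
    {f : MvPolynomial (Fin N) k} {d : ℕ} (hf : f.IsHomogeneous d) (i : ℕ) :
    Module.finrank k (quotComponent I i) ≤
      Module.finrank k (quotComponent (I + Ideal.span {f}) i) +
        quotComponentDim k N I (i - d) := by
  set J := I + Ideal.span {f} with hJ
  have hIJ : I ≤ J := le_sup_left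
  let φ : (MvPolynomial (Fin N) k ⧸ I) →ₗ[k] MvPolynomial (Fin N) k ⧸ J :=
    (Ideal.Quotient.factorₐ k hIJ).toLinearMap
  let ψ := φ.domRestrict (quotComponent I i)
  have hrange : LinearMap.range ψ = quotComponent J i := by
    rw [LinearMap.range_domRestrict, ← Submodule.map_comp]
    rfl
  have hker : Module.finrank k (LinearMap.ker ψ) ≤ quotComponentDim k N I (i - d) := by
    rw [← Submodule.finrank_map_subtype_eq]
    rcases lt_or_ge i d with h | h
    · have hbot : (LinearMap.ker ψ).map (quotComponent I i).subtype = ⊥ := by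
        rw [eq_bot_iff]
        rintro _ ⟨⟨_, p, hp, rfl⟩, hx, rfl⟩
        have hpJ : p ∈ J := Ideal.Quotient.eq_zero_iff_mem.mp hx
        rcases exists_isHomogeneous_sub_mul_mem hI hf hp hpJ with ⟨-, hpI⟩ | ⟨h', -⟩
        · exact Ideal.Quotient.eq_zero_iff_mem.mpr hpI
        · omega
      rw [hbot, finrank_bot]
      exact Nat.zero_le _
    · rw [← Nat.cast_sub h, quotComponentDim_natCast]
      let mulf := LinearMap.mulRight k (Ideal.Quotient.mk I f)
      refine (Submodule.finrank_mono ?_).trans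
        (Submodule.finrank_map_le mulf (quotComponent I (i - d)))
      rintro _ ⟨⟨_, p, hp, rfl⟩, hx, rfl⟩
      have hpJ : p ∈ J := Ideal.Quotient.eq_zero_iff_mem.mp hx
      rcases exists_isHomogeneous_sub_mul_mem hI hf hp hpJ with ⟨h', -⟩ | ⟨-, g, hg, hpg⟩
      · omega
      · exact ⟨Ideal.Quotient.mk I g, Submodule.mem_map_of_mem hg,
          (Ideal.Quotient.eq.mpr hpg).symm.trans rfl⟩
  rw [← LinearMap.finrank_range_add_finrank_ker ψ, hrange]
  omega

theorem sum_max_quotComponentDim_sub_le {N : ℕ} {I : Ideal (MvPolynomial (Fin N) k)}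
    (hI : I.IsHomogeneous (homogeneousSubmodule (Fin N) k))
    [FiniteDimensional k (MvPolynomial (Fin N) k ⧸ I)]
    {f : MvPolynomial (Fin N) k} {d : ℕ} (hf : f.IsHomogeneous d) :
    ∑ᶠ i : ℤ, max ((quotComponentDim k N I i : ℤ) - (quotComponentDim k N I (i - d) : ℤ)) 0 ≤
      (Module.finrank k (MvPolynomial (Fin N) k ⧸ (I + Ideal.span {f})) : ℤ) := by
  set F : ℤ → ℤ := fun i =>
    max ((quotComponentDim k N I i : ℤ) - (quotComponentDim k N I (i - d) : ℤ)) 0 with hF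
  have hfin : FiniteDimensional k (MvPolynomial (Fin N) k ⧸ (I + Ideal.span {f})) :=
    Module.Finite.of_surjective (Ideal.Quotient.factorₐ k
      (le_sup_left : I ≤ I + Ideal.span {f})).toLinearMap
      (Ideal.Quotient.factor_surjective (le_sup_left : I ≤ I + Ideal.span {f}))
  have hJ : (I + Ideal.span {f}).IsHomogeneous (homogeneousSubmodule (Fin N) k) :=
    hI.sup (Ideal.homogeneous_span _ _ (by rintro _ rfl; exact ⟨d, hf⟩))
  by_cases hs : (Function.support F).Finite
  · have hsub : Function.support F ⊆ ((hs.toFinset.image Int.toNat).map Nat.castEmbedding :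
        Finset ℤ) := by
      intro i hi
      have h0 : 0 ≤ i := by
        by_contra! hneg
        exact hi (by simp [hF, quotComponentDim_of_neg I hneg])
      simp only [Finset.coe_map, Set.mem_image, Finset.mem_coe, Finset.mem_image]
      exact ⟨i.toNat, ⟨i, hs.mem_toFinset.mpr hi, rfl⟩, Int.toNat_of_nonneg h0⟩
    rw [finsum_eq_sum_of_support_subset F hsub, Finset.sum_map]
    refine le_trans ?_
      (Nat.cast_le.mpr (sum_finrank_quotComponent_le hJ (hs.toFinset.image Int.toNat)))
    rw [Nat.cast_sum]
    refine Finset.sum_le_sum fun i _ => ?_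
    have := finrank_quotComponent_le hI hf i
    simp only [hF, Nat.castEmbedding_apply, quotComponentDim_natCast]
    omega
  · rw [finsum_of_infinite_support hs]
    positivity

end HomogeneousQuotient

section PowerIdeal

variable {σ k : Type*} [Field k]

theorem mem_span_X_pow_iff {q : ℕ} {p : MvPolynomial σ k} :
    p ∈ Ideal.span (Set.range fun i : σ => (X i : MvPolynomial σ k) ^ q) ↔
      ∀ m : σ →₀ ℕ, (∀ i, m i < q) → coeff m p = 0 := by
  have hset : (Set.range fun i : σ => (X i : MvPolynomial σ k) ^ q) =
      (fun s => monomial s (1 : k)) '' Set.range fun i : σ => Finsupp.single i q := by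
    rw [← Set.range_comp]
    simp [Function.comp_def, X_pow_eq_monomial]
  rw [hset, mem_ideal_span_monomial_image]
  simp only [Set.exists_range_iff, Finsupp.single_le_iff, mem_support_iff]
  refine forall_congr' fun m => ?_
  rw [not_imp_comm]
  push Not
  rfl

/-- The coefficients of the monomials with all exponents less than `q` are coordinates on the
quotient by the `q`-th powers of the variables. -/
theorem nonempty_quot_span_X_pow_equiv [Finite σ] (q : ℕ) :
    Nonempty ((MvPolynomial σ k ⧸
      Ideal.span (Set.range fun i : σ => (X i : MvPolynomial σ k) ^ q)) ≃ₗ[k]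
        ((σ → Fin q) → k)) := by
  classical
  have := Fintype.ofFinite σ
  set I := Ideal.span (Set.range fun i : σ => (X i : MvPolynomial σ k) ^ q)
  let e (a : σ → Fin q) : σ →₀ ℕ := Finsupp.equivFunOnFinite.symm fun i => a i
  have he : Function.Injective e := fun a b h =>
    funext fun i => Fin.ext (DFunLike.congr_fun h i)
  let Φ : MvPolynomial σ k →ₗ[k] (σ → Fin q) → k := LinearMap.pi fun a => lcoeff k (e a)
  have hΦ : Function.Surjective Φ := fun w => by
    refine ⟨∑ a, monomial (e a) (w a), funext fun b => ?_⟩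
    simp [Φ, coeff_monomial, he.eq_iff]
  have hker : I.restrictScalars k = LinearMap.ker Φ := by
    ext p
    rw [Submodule.restrictScalars_mem, mem_span_X_pow_iff, LinearMap.mem_ker]
    refine ⟨fun h => funext fun a => h _ fun i => (a i).2, fun h m hm => ?_⟩
    have hm' : e (fun i => ⟨m i, hm i⟩) = m := Finsupp.ext fun i => rfl
    rw [← hm']
    exact congrFun h _
  exact ⟨(Submodule.quotEquivOfEq (I.restrictScalars k) _ hker).trans
    (Φ.quotKerEquivOfSurjective hΦ)⟩

attribute [local instance] MvPolynomial.gradedAlgebra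

theorem isHomogeneous_span_X_pow (q : ℕ) :
    (Ideal.span (Set.range fun i : σ => (X i : MvPolynomial σ k) ^ q)).IsHomogeneous
      (homogeneousSubmodule σ k) :=
  Ideal.homogeneous_span _ _ (by rintro _ ⟨i, rfl⟩; exact ⟨q, isHomogeneous_X_pow i q⟩)

end PowerIdeal

/-- **Universal bounds for the (generalized) Hilbert-Kunz value.**
For `S = k[x₀,…,x_n]`, `q ≥ 1`, `f` homogeneous of degree `d > 0`, `I = (x₀^q,…,x_n^q)`
and `c_i` the dimension of the degree-`i` component of `S/I`, one has
`Σ_i max{c_i − c_{i−d}, 0} ≤ dim_k S/(I+(f)) ≤ q^{n+1}`, with equality on the right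
iff `f ∈ I`. -/
theorem hilbert_kunz_value_bounds
    (k : Type*) [Field k] (n : ℕ) (q : ℕ) (hq : 1 ≤ q) (d : ℕ) (hd : 0 < d)
    (f : MvPolynomial (Fin (n + 1)) k) (hf : f.IsHomogeneous d)
    (I : Ideal (MvPolynomial (Fin (n + 1)) k))
    (hI : I = Ideal.span (Set.range fun i : Fin (n + 1) => X i ^ q)) :
    (∑ᶠ i : ℤ, max ((quotComponentDim k (n + 1) I i : ℤ) -
          (quotComponentDim k (n + 1) I (i - d) : ℤ)) 0 ≤
        (Module.finrank k (MvPolynomial (Fin (n + 1)) k ⧸ (I + Ideal.span {f})) : ℤ)) ∧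
      Module.finrank k (MvPolynomial (Fin (n + 1)) k ⧸ (I + Ideal.span {f})) ≤
        q ^ (n + 1) ∧
      (Module.finrank k (MvPolynomial (Fin (n + 1)) k ⧸ (I + Ideal.span {f})) =
          q ^ (n + 1) ↔ f ∈ I) := by
  subst hI
  set I := Ideal.span (Set.range fun i : Fin (n + 1) => (X i : MvPolynomial (Fin (n + 1)) k) ^ q)
  obtain ⟨e⟩ := nonempty_quot_span_X_pow_equiv (σ := Fin (n + 1)) (k := k) q
  have hfin : FiniteDimensional k (MvPolynomial (Fin (n + 1)) k ⧸ I) :=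
    Module.Finite.equiv e.symm
  have hdim : Module.finrank k (MvPolynomial (Fin (n + 1)) k ⧸ I) = q ^ (n + 1) := by
    rw [e.finrank_eq]
    simp
  have hIJ : I ≤ I + Ideal.span {f} := le_sup_left
  let φ := (Ideal.Quotient.factorₐ k hIJ).toLinearMap
  have hφ : Function.Surjective φ := Ideal.Quotient.factor_surjective hIJ
  refine ⟨sum_max_quotComponentDim_sub_le (isHomogeneous_span_X_pow q) hf,
    hdim ▸ LinearMap.finrank_le_finrank_of_surjective hφ, fun h => ?_, fun h => ?_⟩
  · have := Module.Finite.of_surjective φ hφ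
    have hinj : Function.Injective φ :=
      (LinearMap.injective_iff_surjective_of_finrank_eq_finrank (hdim.trans h.symm)).mpr hφ
    refine Ideal.Quotient.eq_zero_iff_mem.mp (hinj (Eq.trans ?_ (map_zero φ).symm))
    exact Ideal.Quotient.eq_zero_iff_mem.mpr
      (Ideal.mem_sup_right (Ideal.mem_span_singleton_self f))
  · have : I + Ideal.span {f} = I :=
      sup_eq_left.mpr ((Ideal.span_singleton_le_iff_mem I).mpr h)
    rw [this, hdim]
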